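/- Let p be a prime and n ≥ 0, and let f : ℤ_p → E be a function (E a complete nonarchimedean field extension of ℚ_p) which extends to a rigid analytic function on each open disc a + p^n𝔪_{ℂ_p} of radius p^{-n} around each a ∈ ℤ_p. If f(x) = ∑_k c_k C(x,k) is its Mahler expansion, then lim_{k→∞} |c_k|·r_n^{-k}·ε^k = 0 for every ε < 1, where r_n = p^{-1/((p−1)p^n)}. -/

import Mathlib

open Filter

namespace Aux4

/-- iterated differences of monomials -/
def d : ℕ → ℕ → ℕ → ℤ
  | 0, m, y => (y : ℤ) ^ m
  | l + 1, m, y => d l m (y + 1) - d l m y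

lemma d_rec (l m y : ℕ) :
    d (l + 1) (m + 1) y = y * d (l + 1) m y + (l + 1) * d l m (y + 1) := by
  induction l generalizing y with
  | zero => simp only [d]; push_cast; ring
  | succ l ih =>
    have e1 : d (l + 1 + 1) m y = d (l + 1) m (y + 1) - d (l + 1) m y := rfl
    have e2 : d (l + 1) m (y + 1) = d l m (y + 1 + 1) - d l m (y + 1) := rfl
    rw [d, ih, ih, e1]
    push_cast
    linear_combination (-(l + 1 : ℤ)) * e2

lemma d_zero (l y : ℕ) : d (l + 1) 0 y = 0 := by
  induction l generalizing y with
  | zero => simp [d]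
  | succ l ih => rw [d, ih, ih]; simp

lemma d_lt (m l y : ℕ) (h : m < l) : d l m y = 0 := by
  induction m generalizing l y with
  | zero =>
    obtain ⟨l, rfl⟩ := Nat.exists_eq_succ_of_ne_zero h.ne'
    exact d_zero l y
  | succ m ih =>
    obtain ⟨l, rfl⟩ := Nat.exists_eq_succ_of_ne_zero (Nat.ne_zero_of_lt h)
    rw [Nat.succ_eq_add_one, d_rec, ih _ _ (by omega), ih _ _ (by omega)]; simp

lemma d_dvd (m l y : ℕ) : (l.factorial : ℤ) ∣ d l m y := by
  induction m generalizing l y with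
  | zero =>
    cases l with
    | zero => simp
    | succ l => rw [d_zero]; simp
  | succ m ih =>
    cases l with
    | zero => simp
    | succ l =>
      rw [d_rec]
      refine dvd_add (dvd_mul_of_dvd_right (ih _ _) _) ?_
      rw [Nat.factorial_succ]
      push_cast
      exact mul_dvd_mul_left _ (ih _ _)

variable {E : Type*}

/-- difference operator with step `q` -/
def U (E : Type*) [AddCommGroup E] (q : ℕ) : Module.End ℤ (ℕ → E) where
  toFun F := fun i => F (i + q) - F i
  map_add' F G := by ext i; simp; abel
  map_smul' c F := by ext i; simp [smul_sub]

lemma U_apply [AddCommGroup E] (q : ℕ) (F : ℕ → E) (i : ℕ) : U E q F i = F (i + q) - F i := rfl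

lemma one_add_pow [AddCommGroup E] (q : ℕ) : (1 + U E 1 : Module.End ℤ (ℕ → E)) ^ q = 1 + U E q := by
  induction q with
  | zero => refine LinearMap.ext fun F => funext fun i => ?_; simp [U_apply]
  | succ q ih =>
    rw [pow_succ, ih]
    refine LinearMap.ext fun F => funext fun i => ?_
    simp only [Module.End.mul_apply, U_apply, LinearMap.add_apply, Module.End.one_apply,
      Pi.add_apply, map_add, add_assoc]
    abel

lemma U_pow_sub [AddCommGroup E] (q l a y : ℕ) (F : ℕ → E) :
    (U E q ^ l) F (a + q * y) = (U E 1 ^ l) (fun y => F (a + q * y)) y := by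
  induction l generalizing y with
  | zero => simp
  | succ l ih =>
    rw [pow_succ', pow_succ', Module.End.mul_apply, Module.End.mul_apply, U_apply, U_apply, ← ih,
      ← ih]
    rw [mul_add, mul_one, add_assoc]

lemma U_expand [AddCommGroup E] (q : ℕ) (hq : 0 < q) : (U E 1 : Module.End ℤ (ℕ → E)) ^ q =
    U E q - ∑ j ∈ Finset.Ico 1 q, (U E 1) ^ j * ((q.choose j : ℕ) : Module.End ℤ (ℕ → E)) := by
  have h := one_add_pow (E := E) q
  rw [add_comm, (Commute.one_right _).add_pow, Finset.sum_range_succ, Finset.range_eq_Ico,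
    Finset.sum_eq_sum_Ico_succ_bot hq] at h
  simp only [one_pow, mul_one, pow_zero, Nat.choose_zero_right, Nat.cast_one, zero_add,
    Nat.choose_self] at h
  rw [eq_sub_iff_add_eq, ← add_right_inj (1 : Module.End ℤ (ℕ → E)), ← h]
  abel

lemma comm_U [AddCommGroup E] (a b : ℕ) : Commute (U E a : Module.End ℤ (ℕ → E)) (U E b) := by
  refine LinearMap.ext fun F => funext fun i => ?_
  simp only [Module.End.mul_apply, U_apply]
  rw [add_right_comm]
  abel

lemma mahler_coeff [NontriviallyNormedField E] (c : ℕ → E) (F : ℕ → E)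
    (h : ∀ i, HasSum (fun k => c k * (i.choose k : E)) (F i)) (l i : ℕ) :
    HasSum (fun k => c (k + l) * (i.choose k : E)) ((U E 1 ^ l) F i) := by
  induction l generalizing i with
  | zero => simpa using h i
  | succ l ih =>
    rw [pow_succ', Module.End.mul_apply, U_apply]
    have := (ih (i + 1)).sub (ih i)
    rw [← hasSum_nat_add_iff' 1] at this
    have e1 : (fun k => c (k + (l + 1)) * (i.choose k : E)) = fun k =>
        c (k + 1 + l) * (((i + 1).choose (k + 1) : ℕ) : E) -
          c (k + 1 + l) * ((i.choose (k + 1) : ℕ) : E) := by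
      funext k
      rw [Nat.choose_succ_succ]
      push_cast
      rw [show k + 1 + l = k + (l + 1) by ring]; ring
    rw [e1]
    simpa using this

lemma mahler_coeff_zero [NontriviallyNormedField E] (c : ℕ → E) (F : ℕ → E)
    (h : ∀ i, HasSum (fun k => c k * (i.choose k : E)) (F i)) (l : ℕ) :
    (U E 1 ^ l) F 0 = c l := by
  refine (mahler_coeff c F h l 0).unique ?_
  have := hasSum_single (f := fun k => c (k + l) * ((Nat.choose 0 k : ℕ) : E)) 0 (by
    intro k hk
    obtain ⟨k, rfl⟩ := Nat.exists_eq_succ_of_ne_zero hk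
    simp)
  simpa using this

lemma norm_int_le [NormedField E] [IsUltrametricDist E] (z : ℤ) : ‖(z : E)‖ ≤ 1 :=
  IsUltrametricDist.norm_intCast_le_one E z

lemma power_series_diff [NontriviallyNormedField E] [IsUltrametricDist E] (b h : ℕ → E)
    (C κ : ℝ) (hC : 0 ≤ C) (hκ0 : 0 ≤ κ) (hκ : κ ≤ 1) (hb : ∀ m, ‖b m‖ ≤ C * κ ^ m)
    (hs : ∀ y : ℕ, HasSum (fun m => b m * (y : E) ^ m) (h y)) (l y : ℕ) :
    ‖(U E 1 ^ l) h y‖ ≤ C * κ ^ l * ‖(l.factorial : E)‖ := by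
  have key : ∀ l y, HasSum (fun m => b m * (d l m y : E)) ((U E 1 ^ l) h y) := by
    intro l
    induction l with
    | zero => intro y; simpa [d] using hs y
    | succ l ih =>
      intro y
      rw [pow_succ', Module.End.mul_apply, U_apply]
      have e1 : (fun m => b m * (d (l + 1) m y : E)) = fun m =>
          b m * (d l m (y + 1) : E) - b m * (d l m y : E) := by
        funext m
        rw [d]; push_cast; ring
      rw [e1]
      exact (ih (y + 1)).sub (ih y)
  rw [← (key l y).tsum_eq]
  refine IsUltrametricDist.norm_tsum_le_of_forall_le_of_nonneg (by positivity) fun m => ?_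
  rcases lt_or_ge m l with hm | hm
  · rw [d_lt m l y hm]; simp; positivity
  · obtain ⟨z, hz⟩ := d_dvd m l y
    rw [hz, norm_mul]
    push_cast
    rw [norm_mul]
    have h1 : ‖b m‖ ≤ C * κ ^ l := (hb m).trans
      (mul_le_mul_of_nonneg_left (pow_le_pow_of_le_one hκ0 hκ hm) hC)
    have h2 := norm_int_le (E := E) z
    calc _ ≤ (C * κ ^ l) * (‖(l.factorial : E)‖ * 1) := by gcongr
      _ = _ := by ring

lemma norm_sub_le_max_aux [NormedField E] [IsUltrametricDist E] (x y : E) :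
    ‖x - y‖ ≤ max ‖x‖ ‖y‖ := by
  rw [sub_eq_add_neg, ← norm_neg y]
  exact IsUltrametricDist.norm_add_le_max x (-y)

lemma main_induction [NontriviallyNormedField E] [IsUltrametricDist E] (q : ℕ) (hq : 0 < q)
    (F : ℕ → E) (r R D : ℝ) (hr : 0 < r) (hrR : r ≤ R) (hR : R ≤ 1) (hD : 0 ≤ D)
    (hch : ∀ j, 0 < j → j < q → ‖(q.choose j : E)‖ ≤ r ^ (q - j))
    (hU : ∀ l i, ‖(U E q ^ l) F i‖ ≤ D * R ^ q * (R ^ q) ^ l) (s l i : ℕ) :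
    ‖(U E 1 ^ s * U E q ^ l) F i‖ ≤ D * R ^ (s + q * l) := by
  have hR0 : 0 < R := hr.trans_le hrR
  induction s using Nat.strong_induction_on generalizing l i with
  | _ s ih =>
  rcases lt_or_ge s q with hs | hs
  · clear ih
    have : ∀ i, ‖(U E 1 ^ s * U E q ^ l) F i‖ ≤ D * R ^ q * (R ^ q) ^ l := by
      clear hs
      induction s with
      | zero => intro i; simpa using hU l i
      | succ s ih =>
        intro i
        rw [pow_succ', mul_assoc, Module.End.mul_apply, U_apply]
        exact (norm_sub_le_max_aux _ _).trans (max_le (ih _) (ih _))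
    refine (this i).trans ?_
    rw [← pow_mul, mul_assoc, ← pow_add]
    exact mul_le_mul_of_nonneg_left (pow_le_pow_of_le_one hR0.le hR (by omega)) hD
  · obtain ⟨t, rfl⟩ := Nat.exists_eq_add_of_le' hs
    have e : (U E 1 : Module.End ℤ (ℕ → E)) ^ (t + q) * U E q ^ l =
        U E 1 ^ t * U E q ^ (l + 1) - ∑ j ∈ Finset.Ico 1 q,
          ((q.choose j : ℕ) : Module.End ℤ (ℕ → E)) * (U E 1 ^ (t + j) * U E q ^ l) := by
      rw [pow_add, U_expand q hq, mul_sub, sub_mul, pow_succ' (U E q), mul_assoc, Finset.mul_sum,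
        Finset.sum_mul]
      congr 1
      refine Finset.sum_congr rfl fun j _ => ?_
      rw [← mul_assoc, ← pow_add, ← (Nat.cast_commute (q.choose j) _).eq, mul_assoc]
    rw [e, LinearMap.sub_apply, Pi.sub_apply]
    refine (norm_sub_le_max_aux _ _).trans (max_le ?_ ?_)
    · refine (ih t (by omega) _ _).trans (le_of_eq ?_)
      ring
    · rw [LinearMap.sum_apply, Finset.sum_apply]
      refine IsUltrametricDist.norm_sum_le_of_forall_le_of_nonneg (by positivity) fun j hj => ?_
      rw [Finset.mem_Ico] at hj
      have h1 := ih (t + j) (by omega) l i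
      have h2 := hch j (by omega) hj.2
      have h3 : r ^ (q - j) ≤ R ^ (q - j) := by gcongr
      rw [Module.End.mul_apply, Module.End.natCast_apply, Pi.smul_apply, nsmul_eq_mul, norm_mul]
      calc _ ≤ R ^ (q - j) * (D * R ^ (t + j + q * l)) := by
            gcongr
            exact h2.trans h3
        _ = D * R ^ ((q - j) + (t + j + q * l)) := by rw [pow_add]; ring
        _ = _ := by congr 2; omega

/-! Real / p-adic estimates -/

lemma pow_ineq (p : ℕ) (hp : 2 ≤ p) (n v w : ℕ) (h : v + w ≤ n + 1) :
    p ^ (v + w) ≤ p ^ v + w * ((p - 1) * p ^ n) := by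
  induction w with
  | zero => simp
  | succ w ih =>
    have h1 := ih (by omega)
    have h2 : p ^ (v + w) ≤ p ^ n := Nat.pow_le_pow_right (by omega) (by omega)
    obtain ⟨k, rfl⟩ : ∃ k, p = k + 1 := ⟨p - 1, by omega⟩
    simp only [Nat.add_sub_cancel] at *
    calc (k + 1) ^ (v + (w + 1)) = (k + 1) ^ (v + w) + k * (k + 1) ^ (v + w) := by ring
      _ ≤ _ := by nlinarith

lemma choose_bound (p : ℕ) [hp : Fact p.Prime] (n : ℕ) (r : ℝ) (hr0 : 0 < r) (hr1 : r < 1)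
    (hr : r ^ ((p - 1) * p ^ n) = (p : ℝ)⁻¹) (j : ℕ) (hj : 0 < j) (hjq : j < p ^ (n + 1)) :
    ‖((p ^ (n + 1)).choose j : ℚ_[p])‖ ≤ r ^ (p ^ (n + 1) - j) := by
  have hp2 := hp.out.two_le
  have hp0 : (0 : ℝ) < p := by exact_mod_cast hp.out.pos
  set v := padicValNat p j with hv
  have hvj : p ^ v ≤ j := Nat.le_of_dvd hj pow_padicValNat_dvd
  have hvn : v < n + 1 := (Nat.pow_lt_pow_iff_right (by omega)).1 (hvj.trans_lt hjq)
  have hnj : ‖(j : ℚ_[p])‖ = (p : ℝ)⁻¹ ^ v := by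
    rw [Padic.norm_eq_zpow_neg_valuation (by exact_mod_cast hj.ne'), Padic.valuation_natCast]
    simp [hv]
  obtain ⟨w, hw⟩ := Nat.exists_eq_add_of_lt hvn
  have key : (j : ℚ_[p]) * ((p ^ (n + 1)).choose j : ℚ_[p]) =
      (p : ℚ_[p]) ^ (n + 1) * ((p ^ (n + 1) - 1).choose (j - 1) : ℕ) := by
    have := Nat.add_one_mul_choose_eq (p ^ (n + 1) - 1) (j - 1)
    rw [Nat.sub_add_cancel (by omega), Nat.sub_add_cancel (by omega)] at this
    rw [mul_comm]
    exact_mod_cast this.symm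
  have h1 : (p : ℝ)⁻¹ ^ v * ‖((p ^ (n + 1)).choose j : ℚ_[p])‖ ≤ (p : ℝ)⁻¹ ^ (n + 1) := by
    rw [← hnj, ← norm_mul, key, norm_mul, norm_pow, Padic.norm_p]
    exact mul_le_of_le_one_right (by positivity) (IsUltrametricDist.norm_natCast_le_one _ _)
  have h2 : ‖((p ^ (n + 1)).choose j : ℚ_[p])‖ ≤ (p : ℝ)⁻¹ ^ (w + 1) := by
    have e : (p : ℝ)⁻¹ ^ (n + 1) = (p : ℝ)⁻¹ ^ v * (p : ℝ)⁻¹ ^ (w + 1) := by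
      rw [← pow_add]; congr 1
    rw [e] at h1
    exact le_of_mul_le_mul_left h1 (by positivity)
  refine h2.trans ?_
  rw [← hr, ← pow_mul]
  refine pow_le_pow_of_le_one hr0.le hr1.le ?_
  have := pow_ineq p hp2 n v (w + 1) (by omega)
  rw [show v + (w + 1) = n + 1 by omega] at this
  rw [mul_comm ((p - 1) * p ^ n)]
  omega

lemma factorial_bound (p : ℕ) [hp : Fact p.Prime] (t : ℝ) (ht0 : 0 < t) (ht1 : t < 1)
    (ht : t ^ (p - 1) = (p : ℝ)⁻¹) (l : ℕ) :
    ‖(l.factorial : ℚ_[p])‖ ≤ p * (l + 1) * t ^ l := by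
  have hp2 := hp.out.two_le
  have hp0 : (0 : ℝ) < p := by exact_mod_cast hp.out.pos
  rw [Padic.norm_eq_zpow_neg_valuation (by exact_mod_cast l.factorial_ne_zero),
    Padic.valuation_natCast, zpow_neg, zpow_natCast, ← inv_pow, ← ht, ← pow_mul,
    sub_one_mul_padicValNat_factorial]
  have hs : (p.digits l).sum ≤ (p - 1) * (p.digits l).length := by
    have := List.sum_le_card_nsmul (p.digits l) (p - 1)
      (fun x hx => Nat.le_sub_one_of_lt (Nat.digits_lt_base (by omega) hx))
    rw [mul_comm]; simpa using this
  have hlen : p ^ (p.digits l).length ≤ p * (l + 1) := by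
    rcases Nat.eq_zero_or_pos l with rfl | hl
    · simp; omega
    · have := Nat.base_pow_length_digits_le p l (by omega) hl.ne'
      nlinarith
  have hsl : (p.digits l).sum ≤ l := Nat.digit_sum_le p l
  set s := (p.digits l).sum
  have h1 : t ^ l = t ^ (l - s) * t ^ s := by rw [← pow_add]; congr 1; omega
  have h2 : (1 : ℝ) ≤ p * (l + 1) * t ^ s := by
    have : ((p : ℝ)⁻¹) ^ (p.digits l).length ≤ t ^ s := by
      rw [← ht, ← pow_mul]
      exact pow_le_pow_of_le_one ht0.le ht1.le hs
    have h3 : (p : ℝ) ^ (p.digits l).length ≤ p * (l + 1) := by exact_mod_cast hlen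
    calc (1 : ℝ) = (p : ℝ) ^ (p.digits l).length * ((p : ℝ)⁻¹) ^ (p.digits l).length := by
          rw [← mul_pow, mul_inv_cancel₀ hp0.ne', one_pow]
      _ ≤ _ := by gcongr
  rw [h1]
  calc t ^ (l - s) = t ^ (l - s) * 1 := by ring
    _ ≤ t ^ (l - s) * (p * (l + 1) * t ^ s) := by gcongr
    _ = _ := by ring

end Aux4

namespace Aux4

lemma choose_eq (K : Type*) [Field K] [CharZero K] (i k : ℕ) :
    (∏ j ∈ Finset.range k, ((i : K) - (j : K))) / (k.factorial : K) = (i.choose k : K) := by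
  have h := descPochhammer_eval_eq_prod_range k (i : K)
  rw [← h, descPochhammer_eval_eq_descFactorial, Nat.descFactorial_eq_factorial_mul_choose]
  have := k.factorial_ne_zero
  push_cast
  field_simp

lemma poly_bound (x : ℝ) (hx0 : 0 ≤ x) (hx1 : x < 1) :
    ∃ B : ℝ, 0 ≤ B ∧ ∀ l : ℕ, ((l : ℝ) + 1) * x ^ l ≤ B := by
  have h1 := tendsto_self_mul_const_pow_of_lt_one hx0 hx1
  obtain ⟨B, hB⟩ := h1.bddAbove_range
  refine ⟨B + 1, ?_, fun l => ?_⟩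
  · have := hB ⟨0, rfl⟩
    simp at this; linarith
  · have := hB ⟨l, rfl⟩
    have h2 := pow_le_one₀ (n := l) hx0 hx1.le
    simp only at this
    nlinarith

/-- power series bound on one residue class -/
lemma disc_bound (p : ℕ) [hp : Fact p.Prime] (n : ℕ)
    (E : Type*) [NontriviallyNormedField E] [NormedAlgebra ℚ_[p] E]
    [IsUltrametricDist E] [CompleteSpace E]
    (hext : ∀ q : ℚ_[p], ‖algebraMap ℚ_[p] E q‖ = ‖q‖)
    (f : ℤ_[p] → E) (a : ℕ)
    (han : ∃ g : ℕ → E,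
      (∀ ρ : ℝ, 0 < ρ → ρ < (p : ℝ) ^ (-(n : ℤ)) →
        Tendsto (fun m => ‖g m‖ * ρ ^ m) atTop (nhds 0)) ∧
      (∀ x : ℤ_[p], ‖x - (a : ℤ_[p])‖ < (p : ℝ) ^ (-(n : ℤ)) →
        f x = ∑' m : ℕ, g m *
          (algebraMap ℚ_[p] E ((x : ℚ_[p]) - ((a : ℤ_[p]) : ℚ_[p]))) ^ m))
    (δ : ℝ) (hδ : 1 / 2 < δ) (hδ1 : δ < 1) :
    ∃ C : ℝ, 0 ≤ C ∧ ∀ l y : ℕ,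
      ‖(U E (p ^ (n + 1)) ^ l) (fun i => f i) (a + p ^ (n + 1) * y)‖ ≤
        C * ((p : ℝ)⁻¹ / δ) ^ l * ‖(l.factorial : E)‖ := by
  obtain ⟨g, hg, hfg⟩ := han
  have hp0 : (0 : ℝ) < p := by exact_mod_cast hp.out.pos
  have hp2 : (2 : ℝ) ≤ p := by exact_mod_cast hp.out.two_le
  have hδ0 : 0 < δ := by linarith
  have hpn : (p : ℝ) ^ (-(n : ℤ)) = (p : ℝ)⁻¹ ^ n := by simp
  rw [hpn] at hg hfg
  have hκ1 : (p : ℝ)⁻¹ / δ < 1 := by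
    rw [div_lt_one hδ0]
    have : (p : ℝ)⁻¹ ≤ 2⁻¹ := by gcongr
    linarith
  obtain ⟨C, hC⟩ := (hg (δ * (p : ℝ)⁻¹ ^ n) (by positivity)
    (mul_lt_of_lt_one_left (by positivity) hδ1)).bddAbove_range
  have hCS : ∀ m, ‖g m‖ * (δ * (p : ℝ)⁻¹ ^ n) ^ m ≤ C := fun m => hC ⟨m, rfl⟩
  have hC0 : 0 ≤ C := le_trans (by positivity) (hCS 0)
  have hpE : ‖(p : E)‖ = (p : ℝ)⁻¹ := by
    have := hext p
    rwa [map_natCast, Padic.norm_p] at this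
  have hb : ∀ m, ‖g m * ((p : E) ^ (n + 1)) ^ m‖ ≤ C * ((p : ℝ)⁻¹ / δ) ^ m := by
    intro m
    rw [norm_mul, norm_pow, norm_pow, hpE]
    have e : ((p : ℝ)⁻¹ ^ (n + 1)) ^ m =
        (δ * (p : ℝ)⁻¹ ^ n) ^ m * ((p : ℝ)⁻¹ / δ) ^ m := by
      rw [← mul_pow, pow_succ]; congr 1; generalize (p : ℝ)⁻¹ = z; field_simp
    rw [e, ← mul_assoc]
    gcongr
    exact hCS m
  refine ⟨C, hC0, fun l y => ?_⟩
  rw [U_pow_sub]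
  refine power_series_diff (fun m => g m * ((p : E) ^ (n + 1)) ^ m) _ C _ hC0 (by positivity)
    hκ1.le hb (fun y => ?_) l y
  have hsum : Summable fun m => g m * ((p : E) ^ (n + 1)) ^ m * (y : E) ^ m := by
    refine Summable.of_norm_bounded
      ((summable_geometric_of_lt_one (by positivity) hκ1).mul_left C) fun m => ?_
    rw [norm_mul]
    refine (mul_le_of_le_one_right (norm_nonneg _) ?_).trans (hb m)
    rw [norm_pow]
    exact pow_le_one₀ (norm_nonneg _) (IsUltrametricDist.norm_natCast_le_one _ _)
  have hx := hfg ((a + p ^ (n + 1) * y : ℕ) : ℤ_[p]) (by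
    push_cast
    rw [add_sub_cancel_left, norm_mul, norm_pow, PadicInt.norm_p]
    refine (mul_le_of_le_one_right (by positivity) (PadicInt.norm_le_one _)).trans_lt ?_
    refine pow_lt_pow_right_of_lt_one₀ (by positivity) ?_ (Nat.lt_succ_self n)
    exact inv_lt_one_of_one_lt₀ (by linarith))
  rw [hx]
  convert hsum.hasSum using 1
  refine tsum_congr fun m => ?_
  push_cast
  rw [add_sub_cancel_left, mul_pow, mul_assoc]

end Aux4

theorem stmt4 (p : ℕ) [hp : Fact p.Prime] (n : ℕ)
    (E : Type*) [NontriviallyNormedField E] [NormedAlgebra ℚ_[p] E]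
    [IsUltrametricDist E] [CompleteSpace E]
    (hext : ∀ q : ℚ_[p], ‖algebraMap ℚ_[p] E q‖ = ‖q‖)
    (rn : ℝ) (hrn : rn = (p : ℝ) ^ (-(1 / (((p : ℝ) - 1) * (p : ℝ) ^ n)) : ℝ))
    (f : ℤ_[p] → E)
    (han : ∀ a : ℤ_[p], ∃ g : ℕ → E,
      (∀ ρ : ℝ, 0 < ρ → ρ < (p : ℝ) ^ (-(n : ℤ)) →
        Tendsto (fun m => ‖g m‖ * ρ ^ m) atTop (nhds 0)) ∧
      (∀ x : ℤ_[p], ‖x - a‖ < (p : ℝ) ^ (-(n : ℤ)) →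
        f x = ∑' m : ℕ, g m * (algebraMap ℚ_[p] E ((x : ℚ_[p]) - (a : ℚ_[p]))) ^ m))
    (c : ℕ → E)
    (hMahler : ∀ x : ℤ_[p],
      f x = ∑' k : ℕ,
        c k * algebraMap ℚ_[p] E
          ((∏ i ∈ Finset.range k, ((x : ℚ_[p]) - (i : ℚ_[p]))) / (k.factorial : ℚ_[p]))) :
    ∀ ε : ℝ, 0 < ε → ε < 1 →
      Tendsto (fun k => ‖c k‖ * (rn⁻¹) ^ k * ε ^ k) atTop (nhds 0) := by
  intro ε hε0 hε1
  have hp0 : (0 : ℝ) < p := by exact_mod_cast hp.out.pos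
  have hp2 : (2 : ℝ) ≤ p := by exact_mod_cast hp.out.two_le
  have hpn2 := hp.out.two_le
  have hr0 : 0 < rn := by rw [hrn]; positivity
  have hr : rn ^ ((p - 1) * p ^ n) = (p : ℝ)⁻¹ := by
    rw [hrn, ← Real.rpow_natCast, ← Real.rpow_mul hp0.le]
    push_cast [Nat.cast_sub hp.out.one_le]
    have : ((p : ℝ) - 1) ≠ 0 := by linarith
    rw [neg_mul, one_div, inv_mul_cancel₀ (by positivity), Real.rpow_neg_one]
  have hr1 : rn < 1 := by
    rw [hrn]
    refine Real.rpow_lt_one_of_one_lt_of_neg (by linarith) ?_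
    have : 0 < ((p : ℝ) - 1) := by linarith
    rw [neg_lt_zero]; positivity
  obtain ⟨δ, hδm, hδ1⟩ : ∃ δ, max (max ε rn) (1 / 2) < δ ∧ δ < 1 :=
    exists_between (max_lt (max_lt hε1 hr1) (by norm_num))
  have hδ2 : 1 / 2 < δ := (le_max_right _ _).trans_lt hδm
  have hδε : ε < δ := ((le_max_left _ _).trans (le_max_left _ _)).trans_lt hδm
  have hδr : rn < δ := ((le_max_right _ _).trans (le_max_left _ _)).trans_lt hδm
  have hδ0 : 0 < δ := by linarith
  set q := p ^ (n + 1) with hq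
  have hq2 : 2 ≤ q := hpn2.trans (Nat.le_self_pow (by omega) p)
  set F : ℕ → E := fun i => f i with hF
  have hCZ : CharZero E := charZero_of_injective_algebraMap (algebraMap ℚ_[p] E).injective
  have hc : ∀ k, (Aux4.U E 1 ^ k) F 0 = c k := by
    refine Aux4.mahler_coeff_zero c F fun i => ?_
    have h1 := hMahler (i : ℤ_[p])
    have e : ∀ k : ℕ, algebraMap ℚ_[p] E
          ((∏ j ∈ Finset.range k, (((i : ℤ_[p]) : ℚ_[p]) - (j : ℚ_[p]))) / (k.factorial : ℚ_[p]))
          = (i.choose k : E) := by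
      intro k
      rw [PadicInt.coe_natCast, Aux4.choose_eq, map_natCast]
    simp only [e] at h1
    simp only [hF]
    rw [h1]
    refine (summable_of_ne_finset_zero (s := Finset.range (i + 1)) fun k hk => ?_).hasSum
    rw [Nat.choose_eq_zero_of_lt (by simpa using hk)]
    simp
  have hnorm : ∀ m : ℕ, ‖(m : E)‖ = ‖(m : ℚ_[p])‖ := fun m => by
    rw [← hext, map_natCast]
  choose C hC0 hC using fun a : ℕ =>
    Aux4.disc_bound p n E hext f a (han (a : ℤ_[p])) δ hδ2 hδ1
  set CS := ∑ a ∈ Finset.range q, C a with hCS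
  have hCSnonneg : 0 ≤ CS := Finset.sum_nonneg fun a _ => hC0 a
  have hU : ∀ l i, ‖(Aux4.U E q ^ l) F i‖ ≤ CS * ((p : ℝ)⁻¹ / δ) ^ l * ‖(l.factorial : E)‖ := by
    intro l i
    have h1 := hC (i % q) l (i / q)
    rw [← hq, Nat.mod_add_div] at h1
    refine h1.trans ?_
    gcongr
    exact Finset.single_le_sum (f := C) (fun a _ => hC0 a)
      (Finset.mem_range.2 (Nat.mod_lt _ (by omega)))
  set R := rn / δ with hR
  have hR0 : 0 < R := by positivity
  have hR1 : R ≤ 1 := ((div_lt_one hδ0).2 hδr).le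
  have hrR : rn ≤ R := by
    rw [hR, le_div_iff₀ hδ0]; nlinarith
  obtain ⟨B, hB0, hB⟩ := Aux4.poly_bound (δ ^ (q - 1)) (by positivity)
    (pow_lt_one₀ hδ0.le hδ1 (by omega))
  have ht : (rn ^ p ^ n) ^ (p - 1) = (p : ℝ)⁻¹ := by rw [← pow_mul, mul_comm, hr]
  have hrq : rn ^ q = (p : ℝ)⁻¹ * rn ^ p ^ n := by
    rw [← ht, ← pow_succ, Nat.sub_add_cancel (by omega), ← pow_mul, hq, pow_succ]
  have hU2 : ∀ l i, ‖(Aux4.U E q ^ l) F i‖ ≤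
      (CS * p * B / R ^ q) * R ^ q * (R ^ q) ^ l := by
    intro l i
    refine (hU l i).trans ?_
    have h1 := Aux4.factorial_bound p (rn ^ p ^ n) (by positivity)
      (pow_lt_one₀ hr0.le hr1 (by positivity)) ht l
    rw [hnorm]
    have e : (p : ℝ)⁻¹ / δ * rn ^ p ^ n = δ ^ (q - 1) * R ^ q := by
      have : δ ^ q = δ ^ (q - 1) * δ := by rw [← pow_succ]; congr 1; omega
      rw [hR, div_pow, hrq, this]
      field_simp
    rw [div_mul_cancel₀ _ (by positivity)]
    calc _ ≤ CS * ((p : ℝ)⁻¹ / δ) ^ l * (p * (l + 1) * (rn ^ p ^ n) ^ l) := by gcongr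
      _ = CS * p * (l + 1) * ((p : ℝ)⁻¹ / δ * rn ^ p ^ n) ^ l := by rw [mul_pow]; ring
      _ = CS * p * ((l + 1) * (δ ^ (q - 1)) ^ l) * (R ^ q) ^ l := by rw [e, mul_pow]; ring
      _ ≤ _ := by
        gcongr
        exact hB l
  have hfin : ∀ k, ‖c k‖ ≤ (CS * p * B / R ^ q) * R ^ k := by
    intro k
    have := Aux4.main_induction q (by omega) F rn R (CS * p * B / R ^ q) hr0 hrR hR1
      (by positivity) (fun j hj hjq => by
        rw [hnorm]; exact Aux4.choose_bound p n rn hr0 hr1 hr j hj hjq) hU2 k 0 0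
    rwa [pow_zero, mul_one, mul_zero, add_zero, hc] at this
  have hlim : Tendsto (fun k => (CS * p * B / R ^ q) * (ε / δ) ^ k) atTop (nhds 0) := by
    have := (tendsto_pow_atTop_nhds_zero_of_lt_one (by positivity)
      ((div_lt_one hδ0).2 hδε)).const_mul (CS * p * B / R ^ q)
    simpa using this
  refine squeeze_zero (fun k => by positivity) (fun k => ?_) hlim
  have e : ε / δ = R * rn⁻¹ * ε := by rw [hR]; field_simp
  rw [e, mul_pow, mul_pow, ← mul_assoc, ← mul_assoc]
  gcongr
  exact hfin k
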